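/- Comparison principle on (0,∞): Let ū be a super-solution and u̲ a sub-solution of (⋆) on (0,∞) such that: 0 ≤ ū, u̲ ≤ s_+ on (0,∞); ū(r) = ᾱ·r^{γ_+} + o(r^{γ_+}) and u̲(r) = α̲·r^{γ_+} + o(r^{γ_+}) as r → 0, with ᾱ > 0; ū(r) = s_+ − β̄·r^{−2} + o(r^{−2}) and u̲(r) = s_+ − β̲·r^{−2} + o(r^{−2}) as r → ∞, with β̲ > 0; and β̲ ≥ β̄. Then ū(r) ≥ u̲(r) for all r ∈ (0,∞); moreover, if ū(r₀) = u̲(r₀) for some r₀ ∈ (0,∞), then ū ≡ u̲ on (0,∞). -/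

import Mathlib

open Set Filter Topology MeasureTheory
open scoped ENNReal NNReal

/-- `γ₊ = ((1-p) + √((p-1)² + 4q))/2`, the positive root of `γ² + (p-1)γ - q = 0`. -/
noncomputable def gammaPlus (p q : ℝ) : ℝ :=
  ((1 - p) + Real.sqrt ((p - 1) ^ 2 + 4 * q)) / 2

/-- Condition (condF) on the nonlinearity `F` (with `0 < sp` recorded separately). -/
def CondF (F : ℝ → ℝ) (sp : ℝ) : Prop :=
  ContDiff ℝ 1 F ∧ F 0 = 0 ∧ F sp = 0 ∧
    (∀ t ∈ Set.Ioo 0 sp, F t < 0) ∧ (∀ t, sp < t → 0 < F t) ∧ 0 < deriv F sp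

/-- The ODE (⋆) `u'' + (p/r) u' - (q/r²) u = F(u)` holds at the point `r`. -/
def ODEAt (p q : ℝ) (F : ℝ → ℝ) (u : ℝ → ℝ) (r : ℝ) : Prop :=
  deriv (deriv u) r + (p / r) * deriv u r - (q / r ^ 2) * u r = F (u r)

/-- `ψ` is locally Lipschitz on the set `I`. -/
def LocLipOn (I : Set ℝ) (ψ : ℝ → ℝ) : Prop :=
  ∀ x ∈ I, ∃ K : ℝ≥0, ∃ t ∈ nhdsWithin x I, LipschitzOnWith K ψ t

/-- `ψ` is a locally Lipschitz, piecewise `C²` super-solution of (⋆) on `I`: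
outside a locally finite set `S` of jump points it is `C²` and satisfies
`ψ'' + (p/r)ψ' - (q/r²)ψ ≤ F(ψ)`, and at each jump point the one-sided
derivatives exist with `ψ'(r₀⁻) > ψ'(r₀⁺)`. -/
def IsSuperSolutionOn (p q : ℝ) (F : ℝ → ℝ) (I : Set ℝ) (ψ : ℝ → ℝ) : Prop :=
  LocLipOn I ψ ∧
    ∃ S : Set ℝ,
      (∀ x ∈ I, ∃ ε > 0, (S ∩ Set.Ioo (x - ε) (x + ε)).Finite) ∧
      (∀ x ∈ I \ S, ContDiffAt ℝ 2 ψ x ∧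
        deriv (deriv ψ) x + (p / x) * deriv ψ x - (q / x ^ 2) * ψ x ≤ F (ψ x)) ∧
      (∀ x ∈ I ∩ S, ∃ dl dr : ℝ, HasDerivWithinAt ψ dl (Set.Iio x) x ∧
        HasDerivWithinAt ψ dr (Set.Ioi x) x ∧ dr < dl)

/-- `ψ` is a locally Lipschitz, piecewise `C²` sub-solution of (⋆) on `I`. -/
def IsSubSolutionOn (p q : ℝ) (F : ℝ → ℝ) (I : Set ℝ) (ψ : ℝ → ℝ) : Prop :=
  LocLipOn I ψ ∧
    ∃ S : Set ℝ,
      (∀ x ∈ I, ∃ ε > 0, (S ∩ Set.Ioo (x - ε) (x + ε)).Finite) ∧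
      (∀ x ∈ I \ S, ContDiffAt ℝ 2 ψ x ∧
        F (ψ x) ≤ deriv (deriv ψ) x + (p / x) * deriv ψ x - (q / x ^ 2) * ψ x) ∧
      (∀ x ∈ I ∩ S, ∃ dl dr : ℝ, HasDerivWithinAt ψ dl (Set.Iio x) x ∧
        HasDerivWithinAt ψ dr (Set.Ioi x) x ∧ dl < dr)

/-- `u(r) = α·r^γ + o(r^γ)` as `r → 0⁺`. -/
def AsympZero (u : ℝ → ℝ) (α γ : ℝ) : Prop :=
  Filter.Tendsto (fun r : ℝ => (u r - α * r ^ γ) / r ^ γ) (nhdsWithin 0 (Set.Ioi 0)) (nhds 0)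

/-- `u(r) = sp - β·r⁻² + o(r⁻²)` as `r → ∞`. -/
def AsympInfty (u : ℝ → ℝ) (sp β : ℝ) : Prop :=
  Filter.Tendsto (fun r : ℝ => (u r - (sp - β / r ^ 2)) * r ^ 2) Filter.atTop (nhds 0)

/-- Pointwise form of the super-solution property on `(0,∞)`. -/
def PointwiseSuper (p q : ℝ) (F ψ : ℝ → ℝ) : Prop :=
  ∀ x : ℝ, 0 < x →
    (ContDiffAt ℝ 2 ψ x ∧
      deriv (deriv ψ) x + (p / x) * deriv ψ x - (q / x ^ 2) * ψ x ≤ F (ψ x)) ∨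
    ∃ dl dr : ℝ, HasDerivWithinAt ψ dl (Set.Iio x) x ∧
      HasDerivWithinAt ψ dr (Set.Ioi x) x ∧ dr < dl

/-- Pointwise form of the sub-solution property on `(0,∞)`. -/
def PointwiseSub (p q : ℝ) (F ψ : ℝ → ℝ) : Prop :=
  ∀ x : ℝ, 0 < x →
    (ContDiffAt ℝ 2 ψ x ∧
      F (ψ x) ≤ deriv (deriv ψ) x + (p / x) * deriv ψ x - (q / x ^ 2) * ψ x) ∨
    ∃ dl dr : ℝ, HasDerivWithinAt ψ dl (Set.Iio x) x ∧
      HasDerivWithinAt ψ dr (Set.Ioi x) x ∧ dl < dr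

lemma IsSuperSolutionOn.pointwise {p q : ℝ} {F ψ : ℝ → ℝ}
    (h : IsSuperSolutionOn p q F (Set.Ioi 0) ψ) : PointwiseSuper p q F ψ := by
  obtain ⟨-, S, -, h1, h2⟩ := h
  intro x hx
  by_cases hS : x ∈ S
  · exact Or.inr (h2 x ⟨hx, hS⟩)
  · exact Or.inl (h1 x ⟨hx, hS⟩)

lemma IsSubSolutionOn.pointwise {p q : ℝ} {F ψ : ℝ → ℝ}
    (h : IsSubSolutionOn p q F (Set.Ioi 0) ψ) : PointwiseSub p q F ψ := by
  obtain ⟨-, S, -, h1, h2⟩ := h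
  intro x hx
  by_cases hS : x ∈ S
  · exact Or.inr (h2 x ⟨hx, hS⟩)
  · exact Or.inl (h1 x ⟨hx, hS⟩)

lemma continuousAt_of_hasDerivWithinAt_Iio_Ioi {ψ : ℝ → ℝ} {x dl dr : ℝ}
    (hl : HasDerivWithinAt ψ dl (Set.Iio x) x) (hr : HasDerivWithinAt ψ dr (Set.Ioi x) x) :
    ContinuousAt ψ x :=
  continuousAt_iff_continuous_left'_right'.2 ⟨hl.continuousWithinAt, hr.continuousWithinAt⟩

lemma PointwiseSuper.continuousAt {p q : ℝ} {F ψ : ℝ → ℝ} (h : PointwiseSuper p q F ψ)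
    {x : ℝ} (hx : 0 < x) : ContinuousAt ψ x := by
  rcases h x hx with h | ⟨dl, dr, hl, hr, -⟩
  · exact h.1.continuousAt
  · exact continuousAt_of_hasDerivWithinAt_Iio_Ioi hl hr

lemma PointwiseSub.continuousAt {p q : ℝ} {F ψ : ℝ → ℝ} (h : PointwiseSub p q F ψ)
    {x : ℝ} (hx : 0 < x) : ContinuousAt ψ x := by
  rcases h x hx with h | ⟨dl, dr, hl, hr, -⟩
  · exact h.1.continuousAt
  · exact continuousAt_of_hasDerivWithinAt_Iio_Ioi hl hr

/-- The `C²` points have a two-sided derivative, so one-sided derivatives exist everywhere. -/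
lemma PointwiseSuper.exists_one_sided {p q : ℝ} {F ψ : ℝ → ℝ} (h : PointwiseSuper p q F ψ)
    {x : ℝ} (hx : 0 < x) : ∃ dl dr : ℝ, HasDerivWithinAt ψ dl (Set.Iio x) x ∧
      HasDerivWithinAt ψ dr (Set.Ioi x) x ∧ dr ≤ dl := by
  rcases h x hx with h | ⟨dl, dr, hl, hr, h⟩
  · have := (h.1.differentiableAt (by norm_num)).hasDerivAt
    exact ⟨_, _, this.hasDerivWithinAt, this.hasDerivWithinAt, le_rfl⟩
  · exact ⟨dl, dr, hl, hr, h.le⟩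

lemma PointwiseSub.exists_one_sided {p q : ℝ} {F ψ : ℝ → ℝ} (h : PointwiseSub p q F ψ)
    {x : ℝ} (hx : 0 < x) : ∃ dl dr : ℝ, HasDerivWithinAt ψ dl (Set.Iio x) x ∧
      HasDerivWithinAt ψ dr (Set.Ioi x) x ∧ dl ≤ dr := by
  rcases h x hx with h | ⟨dl, dr, hl, hr, h⟩
  · have := (h.1.differentiableAt (by norm_num)).hasDerivAt
    exact ⟨_, _, this.hasDerivWithinAt, this.hasDerivWithinAt, le_rfl⟩
  · exact ⟨dl, dr, hl, hr, h.le⟩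

lemma IsLocalMin.left_le_right_deriv {g : ℝ → ℝ} {x dl dr : ℝ} (hmin : IsLocalMin g x)
    (hl : HasDerivWithinAt g dl (Set.Iio x) x) (hr : HasDerivWithinAt g dr (Set.Ioi x) x) :
    dl ≤ dr := by
  have h1 : dl ≤ 0 := by
    rw [hasDerivWithinAt_iff_tendsto_slope' (by simp)] at hl
    refine le_of_tendsto hl ?_
    filter_upwards [hmin.filter_mono nhdsWithin_le_nhds, self_mem_nhdsWithin] with y hy hy'
    rw [slope_def_field]
    exact div_nonpos_of_nonneg_of_nonpos (by linarith) (by simpa using le_of_lt hy')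
  have h2 : 0 ≤ dr := by
    rw [hasDerivWithinAt_iff_tendsto_slope' (by simp)] at hr
    refine ge_of_tendsto hr ?_
    filter_upwards [hmin.filter_mono nhdsWithin_le_nhds, self_mem_nhdsWithin] with y hy hy'
    rw [slope_def_field]
    exact div_nonneg (by linarith) (by simpa using le_of_lt hy')
  linarith

lemma IsLocalMin.second_deriv_nonneg {g g' : ℝ → ℝ} {x c : ℝ} (hmin : IsLocalMin g x)
    (hg : ∀ᶠ y in 𝓝 x, HasDerivAt g (g' y) y) (hg' : HasDerivAt g' c x) : 0 ≤ c := by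
  by_contra! hc
  have hd : deriv g =ᶠ[𝓝 x] g' := hg.mono fun y hy => hy.deriv
  have hdd : deriv (deriv g) x = c := by rw [hd.deriv_eq]; exact hg'.deriv
  have hmax : IsLocalMax g x :=
    isLocalMax_of_deriv_deriv_neg (by rw [hdd]; exact hc) hmin.deriv_eq_zero
      hg.self_of_nhds.continuousAt
  have hconst : g =ᶠ[𝓝 x] fun _ => g x := by
    filter_upwards [hmin, hmax] with y h1 h2
    exact le_antisymm h2 h1
  have := hconst.deriv.deriv_eq
  simp [hdd] at this
  linarith

/-- If `ub - lb - φ` has a local minimum at `x`, then `x` is not a kink and the differential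
inequality passes to the test function `φ`. -/
lemma test_inequality {p q : ℝ} {F ub lb φ φ' : ℝ → ℝ} {x φ'' : ℝ} (hx : 0 < x)
    (hub : PointwiseSuper p q F ub) (hlb : PointwiseSub p q F lb)
    (hφ : ∀ᶠ y in 𝓝 x, HasDerivAt φ (φ' y) y) (hφ' : HasDerivAt φ' φ'' x)
    (hmin : IsLocalMin (fun y => ub y - lb y - φ y) x) :
    φ'' + (p / x) * φ' x ≤ F (ub x) - F (lb x) + (q / x ^ 2) * (ub x - lb x) := by
  have hφx := hφ.self_of_nhds
  obtain ⟨al, ar, hal, har, ha⟩ := hub.exists_one_sided hx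
  obtain ⟨bl, br, hbl, hbr, hb⟩ := hlb.exists_one_sided hx
  rcases hub x hx with ⟨hu, hu'⟩ | ⟨dl, dr, hl, hr, h⟩
  swap
  · have := hmin.left_le_right_deriv ((hl.sub hbl).sub hφx.hasDerivWithinAt)
      ((hr.sub hbr).sub hφx.hasDerivWithinAt)
    linarith
  rcases hlb x hx with ⟨hv, hv'⟩ | ⟨dl, dr, hl, hr, h⟩
  swap
  · have := hmin.left_le_right_deriv ((hal.sub hl).sub hφx.hasDerivWithinAt)
      ((har.sub hr).sub hφx.hasDerivWithinAt)
    linarith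
  have key : ∀ {ψ : ℝ → ℝ}, ContDiffAt ℝ 2 ψ x →
      (∀ᶠ y in 𝓝 x, HasDerivAt ψ (deriv ψ y) y) ∧
        HasDerivAt (deriv ψ) (deriv (deriv ψ) x) x := by
    intro ψ h
    constructor
    · filter_upwards [h.eventually (by simp)] with y hy
      exact (hy.differentiableAt (by norm_num)).hasDerivAt
    · have : ContDiffAt ℝ 1 (deriv ψ) x := h.derivWithin (by norm_num)
      exact (this.differentiableAt (by norm_num)).hasDerivAt
  obtain ⟨hu1, hu2⟩ := key hu
  obtain ⟨hv1, hv2⟩ := key hv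
  have hg : ∀ᶠ y in 𝓝 x,
      HasDerivAt (fun y => ub y - lb y - φ y) (deriv ub y - deriv lb y - φ' y) y := by
    filter_upwards [hu1, hv1, hφ] with y h1 h2 h3
    exact (h1.sub h2).sub h3
  have h0 := hmin.hasDerivAt_eq_zero hg.self_of_nhds
  have h2 := hmin.second_deriv_nonneg hg ((hu2.sub hv2).sub hφ')
  have h3 : φ' x = deriv ub x - deriv lb x := by linarith
  rw [h3, mul_sub, mul_sub]
  linarith

/-- Data of an ordered pair (sub-solution below super-solution), both with values in `[0, sp]`,
together with a one-sided Lipschitz constant of `F` on `[0, sp]`. -/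
structure OrderedPair (p q sp L : ℝ) (F ub lb : ℝ → ℝ) : Prop where
  hq : 0 < q
  hL : 0 ≤ L
  lip : ∀ x ∈ Icc 0 sp, ∀ y ∈ Icc 0 sp, x ≤ y → F y - F x ≤ L * (y - x)
  super : PointwiseSuper p q F ub
  sub : PointwiseSub p q F lb
  ub_mem : ∀ r : ℝ, 0 < r → ub r ∈ Icc 0 sp
  lb_mem : ∀ r : ℝ, 0 < r → lb r ∈ Icc 0 sp
  le : ∀ r : ℝ, 0 < r → lb r ≤ ub r

namespace OrderedPair

variable {p q sp L : ℝ} {F ub lb : ℝ → ℝ}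

lemma test_le (h : OrderedPair p q sp L F ub lb) {φ φ' : ℝ → ℝ} {x φ'' : ℝ} (hx : 0 < x)
    (hφ : ∀ᶠ y in 𝓝 x, HasDerivAt φ (φ' y) y) (hφ' : HasDerivAt φ' φ'' x)
    (hmin : IsLocalMin (fun y => ub y - lb y - φ y) x) :
    φ'' + (p / x) * φ' x ≤ (L + q / x ^ 2) * (ub x - lb x) := by
  have h1 := test_inequality hx h.super h.sub hφ hφ' hmin
  have h2 := h.lip _ (h.lb_mem x hx) _ (h.ub_mem x hx) (h.le x hx)
  linarith

/-- A strict sub-solution of the linearised inequality that lies below `ub - lb` at the ends of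
an interval lies below it on the interval. -/
lemma barrier_le (h : OrderedPair p q sp L F ub lb) {φ φ' φ'' : ℝ → ℝ} {a b : ℝ} (ha : 0 < a)
    (hφ : ∀ x : ℝ, 0 < x → HasDerivAt φ (φ' x) x)
    (hφ' : ∀ x : ℝ, 0 < x → HasDerivAt φ' (φ'' x) x)
    (hstrict : ∀ x ∈ Ioo a b, (L + q / x ^ 2) * φ x < φ'' x + (p / x) * φ' x)
    (hφa : φ a ≤ ub a - lb a) (hφb : φ b ≤ ub b - lb b) :
    ∀ x ∈ Icc a b, φ x ≤ ub x - lb x := by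
  intro y hy
  have hpos : ∀ x ∈ Icc a b, 0 < x := fun x hx => ha.trans_le hx.1
  have hcont : ContinuousOn (fun y => ub y - lb y - φ y) (Icc a b) := fun x hx =>
    (((h.super.continuousAt (hpos x hx)).sub (h.sub.continuousAt (hpos x hx))).sub
      (hφ x (hpos x hx)).continuousAt).continuousWithinAt
  obtain ⟨x, hx, hmin⟩ := isCompact_Icc.exists_isMinOn ⟨y, hy⟩ hcont
  by_contra! hlt
  have hxlt : ub x - lb x - φ x < 0 := by
    have : ub x - lb x - φ x ≤ ub y - lb y - φ y := hmin hy
    linarith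
  have hxa : a < x := lt_of_le_of_ne hx.1 (by rintro rfl; linarith)
  have hxb : x < b := lt_of_le_of_ne hx.2 (by rintro rfl; linarith)
  have hx0 := hpos x hx
  have h1 := h.test_le hx0 (φ := φ) (φ' := φ')
    (by filter_upwards [lt_mem_nhds hx0] with z hz using hφ z hz) (hφ' x hx0)
    (hmin.isLocalMin (Icc_mem_nhds hxa hxb))
  have h2 := hstrict x ⟨hxa, hxb⟩
  have hK : 0 ≤ L + q / x ^ 2 := add_nonneg h.hL (div_nonneg h.hq.le (by positivity))
  have h3 := mul_le_mul_of_nonneg_left (show ub x - lb x ≤ φ x by linarith) hK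
  linarith

/-- Core of the strong maximum principle, with the exponential barrier `ε(exp(k(r-r₀)) - 1)`. -/
lemma false_of_exp_barrier (h : OrderedPair p q sp L F ub lb) {a b r₀ r₁ k : ℝ} (ha : 0 < a)
    (hab : a < b) (hr : r₀ = a ∧ r₁ = b ∧ 0 < k ∨ r₀ = b ∧ r₁ = a ∧ k < 0)
    (hk : ∀ x ∈ Icc a b, L + q / x ^ 2 < k ^ 2 + (p / x) * k)
    (h0 : ub r₀ = lb r₀) (h1 : lb r₁ < ub r₁) : False := by
  have hk1 : 0 < k * (r₁ - r₀) := by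
    rcases hr with ⟨rfl, rfl, hk'⟩ | ⟨rfl, rfl, hk'⟩
    · exact mul_pos hk' (by linarith)
    · exact mul_pos_of_neg_of_neg hk' (by linarith)
  have hr0 : r₀ ∈ Icc a b := by
    rcases hr with ⟨rfl, rfl, hk'⟩ | ⟨rfl, rfl, hk'⟩ <;> simp [hab.le]
  have hr0pos : 0 < r₀ := ha.trans_le hr0.1
  have hE : 0 < Real.exp (k * (r₁ - r₀)) - 1 := by
    have := Real.one_lt_exp_iff.2 hk1
    linarith
  set ε : ℝ := (ub r₁ - lb r₁) / (Real.exp (k * (r₁ - r₀)) - 1) with hε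
  have hεpos : 0 < ε := div_pos (by linarith) hE
  let φ : ℝ → ℝ := fun r => ε * (Real.exp (k * (r - r₀)) - 1)
  let φ' : ℝ → ℝ := fun r => ε * (Real.exp (k * (r - r₀)) * k)
  let φ'' : ℝ → ℝ := fun r => ε * (Real.exp (k * (r - r₀)) * k * k)
  have hexp : ∀ x : ℝ, HasDerivAt (fun r => Real.exp (k * (r - r₀)))
      (Real.exp (k * (x - r₀)) * k) x := by
    intro x
    have : HasDerivAt (fun r : ℝ => k * (r - r₀)) k x := by
      simpa using ((hasDerivAt_id x).sub_const r₀).const_mul k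
    exact this.exp
  have hφ : ∀ x : ℝ, HasDerivAt φ (φ' x) x := fun x => ((hexp x).sub_const 1).const_mul ε
  have hφ' : ∀ x : ℝ, HasDerivAt φ' (φ'' x) x := fun x => ((hexp x).mul_const k).const_mul ε
  have hφ0 : φ r₀ = 0 := by simp [φ]
  have hφ1 : φ r₁ = ub r₁ - lb r₁ := by
    simp only [φ, hε]
    exact div_mul_cancel₀ _ hE.ne'
  have hstrict : ∀ x ∈ Icc a b, (L + q / x ^ 2) * φ x < φ'' x + (p / x) * φ' x := by
    intro x hx
    have hK : 0 < L + q / x ^ 2 :=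
      add_pos_of_nonneg_of_pos h.hL (div_pos h.hq (by have := ha.trans_le hx.1; positivity))
    have h2 := mul_lt_mul_of_pos_left (hk x hx)
      (mul_pos hεpos (Real.exp_pos (k * (x - r₀))))
    have h3 := mul_pos hεpos hK
    simp only [φ, φ', φ'']
    nlinarith
  have hle : ∀ x ∈ Icc a b, φ x ≤ ub x - lb x := by
    refine h.barrier_le ha (fun x _ => hφ x) (fun x _ => hφ' x)
      (fun x hx => hstrict x (Ioo_subset_Icc_self hx)) ?_ ?_
    · rcases hr with ⟨rfl, rfl, hk'⟩ | ⟨rfl, rfl, hk'⟩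
      · rw [hφ0, h0, sub_self]
      · exact hφ1.le
    · rcases hr with ⟨rfl, rfl, hk'⟩ | ⟨rfl, rfl, hk'⟩
      · exact hφ1.le
      · rw [hφ0, h0, sub_self]
  have hneg : ∀ x : ℝ, k * (x - r₀) ≤ 0 → φ x ≤ 0 := by
    intro x hx
    have := Real.exp_le_one_iff.2 hx
    exact mul_nonpos_of_nonneg_of_nonpos hεpos.le (by linarith)
  have hmin : IsLocalMin (fun y => ub y - lb y - φ y) r₀ := by
    have key : ∀ᶠ y in 𝓝 r₀, 0 < y ∧ (k * (y - r₀) ≤ 0 ∨ y ∈ Icc a b) := by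
      rcases hr with ⟨rfl, rfl, hk'⟩ | ⟨rfl, rfl, hk'⟩
      · filter_upwards [lt_mem_nhds hr0pos, gt_mem_nhds hab] with y hy1 hy2
        refine ⟨hy1, ?_⟩
        rcases le_total y r₀ with h | h
        · exact Or.inl (mul_nonpos_of_nonneg_of_nonpos hk'.le (by linarith))
        · exact Or.inr ⟨h, hy2.le⟩
      · filter_upwards [lt_mem_nhds hr0pos, lt_mem_nhds hab] with y hy1 hy2
        refine ⟨hy1, ?_⟩
        rcases le_total r₀ y with h | h
        · exact Or.inl (mul_nonpos_of_nonpos_of_nonneg hk'.le (by linarith))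
        · exact Or.inr ⟨hy2.le, h⟩
    filter_upwards [key] with y ⟨hy, hy'⟩
    rw [hφ0, h0]
    rcases hy' with hy' | hy'
    · have := hneg y hy'
      have := h.le y hy
      linarith
    · have := hle y hy'
      linarith
  have h2 := h.test_le hr0pos (Eventually.of_forall hφ) (hφ' r₀) hmin
  have h3 := hstrict r₀ hr0
  rw [hφ0] at h3
  rw [h0, sub_self] at h2
  linarith

/-- Strong maximum principle. -/
lemma eq_of_touch (hp : 0 ≤ p) (h : OrderedPair p q sp L F ub lb) {r₀ : ℝ} (hr₀ : 0 < r₀)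
    (h0 : ub r₀ = lb r₀) {r : ℝ} (hr : 0 < r) : ub r = lb r := by
  by_contra hne
  have h1 : lb r < ub r := lt_of_le_of_ne (h.le r hr) (Ne.symm hne)
  have hqa : ∀ a x : ℝ, 0 < a → a ≤ x → q / x ^ 2 ≤ q / a ^ 2 := fun a x ha hx => by
    have := h.hq.le
    gcongr
  rcases lt_trichotomy r₀ r with hlt | rfl | hlt
  · set K := L + q / r₀ ^ 2 with hK
    have hKpos : 0 < K := add_pos_of_nonneg_of_pos h.hL (div_pos h.hq (by positivity))
    refine h.false_of_exp_barrier hr₀ hlt (k := K + 1) (Or.inl ⟨rfl, rfl, by linarith⟩)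
      (fun x hx => ?_) h0 h1
    have h2 := hqa r₀ x hr₀ hx.1
    have h3 : 0 ≤ p / x * (K + 1) :=
      mul_nonneg (div_nonneg hp (hr₀.le.trans hx.1)) (by linarith)
    nlinarith
  · exact hne h0
  · set K := L + q / r ^ 2 with hK
    have hKpos : 0 < K := add_pos_of_nonneg_of_pos h.hL (div_pos h.hq (by positivity))
    have hpr : 0 ≤ p / r := div_nonneg hp hr.le
    refine h.false_of_exp_barrier hr hlt (k := -(p / r + K + 1))
      (Or.inr ⟨rfl, rfl, by linarith⟩) (fun x hx => ?_) h0 h1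
    have h2 := hqa r x hr hx.1
    have h3 : p / x ≤ p / r := by gcongr; exact hx.1
    nlinarith

/-- Hopf-type lemma at the singular endpoint `0`. -/
lemma exists_rpow_le (h : OrderedPair p q sp L F ub lb) {γ : ℝ} (hγ : 0 < γ)
    (hroot : γ ^ 2 + (p - 1) * γ - q = 0) (hγp : 0 < 2 * γ + p)
    (hpos : ∀ r : ℝ, 0 < r → lb r < ub r) :
    ∃ ε > 0, ∃ δ > 0, ∀ r ∈ Ioc 0 δ, ε * r ^ γ ≤ ub r - lb r := by
  set k : ℝ := (2 * L + 1) / (2 * γ + p) with hk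
  have hkpos : 0 < k := div_pos (by have := h.hL; linarith) hγp
  have hkmul : k * (2 * γ + p) = 2 * L + 1 := div_mul_cancel₀ _ hγp.ne'
  set δ : ℝ := 1 / (k + 1) with hδ
  have hδpos : 0 < δ := by positivity
  have hδk : δ * (k + 1) = 1 := by rw [hδ]; field_simp
  have hφδ : 0 < δ ^ γ * (1 + k * δ) := by positivity
  set ε : ℝ := (ub δ - lb δ) / (δ ^ γ * (1 + k * δ)) with hε
  have hεpos : 0 < ε := div_pos (by have := hpos δ hδpos; linarith) hφδ
  have hsmall : ∀ η > 0, ∀ r ∈ Ioc 0 δ, ε * (r ^ γ * (1 + k * r)) - η ≤ ub r - lb r := by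
    intro η hη r hr
    let φ : ℝ → ℝ := fun r => ε * (r ^ γ * (1 + k * r)) - η
    let φ' : ℝ → ℝ := fun r => ε * (γ * r ^ (γ - 1) * (1 + k * r) + r ^ γ * k)
    let φ'' : ℝ → ℝ := fun r => ε * (γ * ((γ - 1) * r ^ (γ - 1 - 1)) * (1 + k * r)
      + γ * r ^ (γ - 1) * k + γ * r ^ (γ - 1) * k)
    have hlin : ∀ x : ℝ, HasDerivAt (fun r : ℝ => 1 + k * r) k x := fun x => by
      simpa using ((hasDerivAt_id x).const_mul k).const_add 1
    have hφ : ∀ x : ℝ, 0 < x → HasDerivAt φ (φ' x) x := fun x hx =>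
      (((Real.hasDerivAt_rpow_const (Or.inl hx.ne')).mul (hlin x)).const_mul ε).sub_const η
    have hφ' : ∀ x : ℝ, 0 < x → HasDerivAt φ' (φ'' x) x := fun x hx =>
      (((((Real.hasDerivAt_rpow_const (Or.inl hx.ne')).const_mul γ).mul (hlin x)).add
        ((Real.hasDerivAt_rpow_const (Or.inl hx.ne')).mul_const k)).const_mul ε)
    have hlim : Tendsto (fun r : ℝ => ε * (r ^ γ * (1 + k * r))) (𝓝[>] 0) (𝓝 0) := by
      have : ContinuousAt (fun r : ℝ => ε * (r ^ γ * (1 + k * r))) 0 :=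
        continuousAt_const.mul ((Real.continuousAt_rpow_const _ _ (Or.inr hγ.le)).mul
          (hlin 0).continuousAt)
      have h2 := this.tendsto
      simp only [Real.zero_rpow hγ.ne', zero_mul, mul_zero] at h2
      exact h2.mono_left nhdsWithin_le_nhds
    obtain ⟨a, ⟨ha1, ha2⟩, ha0⟩ := (((hlim.eventually (gt_mem_nhds hη)).and
      (mem_nhdsWithin_of_mem_nhds (gt_mem_nhds hr.1))).and self_mem_nhdsWithin).exists
    have ha0' : 0 < a := ha0
    refine h.barrier_le (φ := φ) ha0' (b := δ) hφ hφ' ?_ ?_ ?_ r ⟨le_of_lt ha2, hr.2⟩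
    · intro x hx
      have hx0 : 0 < x := ha0'.trans hx.1
      have hx1 : x * (k + 1) ≤ 1 := by
        exact (mul_le_mul_of_nonneg_right hx.2.le (by linarith)).trans_eq hδk
      have hA : 0 < x ^ γ := Real.rpow_pos_of_pos hx0 γ
      have e1 : x ^ (γ - 1) = x ^ γ / x := Real.rpow_sub_one hx0.ne' γ
      have e2 : x ^ (γ - 1 - 1) = x ^ γ / x / x := by rw [Real.rpow_sub_one hx0.ne', e1]
      have hid : φ'' x + p / x * φ' x - (L + q / x ^ 2) * φ x
          = ε * x ^ γ / x * (k * (2 * γ + p) - L * (x * (1 + k * x)))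
            + (L + q / x ^ 2) * η
            + ε * x ^ γ / x ^ 2 * (1 + k * x) * (γ ^ 2 + (p - 1) * γ - q) := by
        simp only [φ, φ', φ'', e1, e2]
        field_simp
        ring
      rw [hroot, hkmul, mul_zero, add_zero] at hid
      have hxk : x * (1 + k * x) ≤ 2 := by nlinarith
      have hp1 : 0 < 2 * L + 1 - L * (x * (1 + k * x)) := by
        nlinarith [mul_le_mul_of_nonneg_left hxk h.hL]
      have hp2 : 0 < ε * x ^ γ / x * (2 * L + 1 - L * (x * (1 + k * x))) := by positivity
      have hp3 : 0 ≤ (L + q / x ^ 2) * η :=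
        mul_nonneg (add_nonneg h.hL (div_nonneg h.hq.le (by positivity))) (le_of_lt hη)
      linarith
    · have := hpos a ha0'
      have ha1' : ε * (a ^ γ * (1 + k * a)) < η := ha1
      simp only [φ]
      linarith
    · have : ε * (δ ^ γ * (1 + k * δ)) = ub δ - lb δ := div_mul_cancel₀ _ hφδ.ne'
      have hη' : 0 < η := hη
      simp only [φ]
      linarith
  refine ⟨ε, hεpos, δ, hδpos, fun r hr => ?_⟩
  have h1 : ε * (r ^ γ * (1 + k * r)) ≤ ub r - lb r :=
    le_of_forall_pos_le_add fun η hη => by have := hsmall η hη r hr; linarith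
  have h2 : 0 ≤ ε * (r ^ γ * (k * r)) := by have := hr.1; positivity
  linarith

end OrderedPair

lemma PointwiseSuper.comp_mul_left {p q sp : ℝ} {F ub : ℝ → ℝ}
    (hF : ∀ t ∈ Icc 0 sp, F t ≤ 0) (h : PointwiseSuper p q F ub)
    (hmem : ∀ r : ℝ, 0 < r → ub r ∈ Icc 0 sp) {l : ℝ} (hl : 1 ≤ l) :
    PointwiseSuper p q F (fun r => ub (l * r)) := by
  intro x hx
  have hl0 : 0 < l := by linarith
  have hlx : 0 < l * x := mul_pos hl0 hx
  have hlin : HasDerivAt (fun r : ℝ => l * r) l x := by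
    simpa using (hasDerivAt_id x).const_mul l
  rcases h (l * x) hlx with ⟨h1, h2⟩ | ⟨dl, dr, h1, h2, h3⟩
  · left
    refine ⟨h1.comp x (contDiffAt_const.mul contDiffAt_id), ?_⟩
    have e1 : deriv (fun r => ub (l * r)) = fun r => l * deriv ub (l * r) := by
      funext r
      simpa using deriv_comp_mul_left l ub r
    have e2 : deriv (fun r => l * deriv ub (l * r)) x = l * (l * deriv (deriv ub) (l * x)) := by
      have := deriv_comp_mul_left l (deriv ub) x
      rw [deriv_const_mul_field, this, smul_eq_mul]
    rw [e1, e2]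
    have hid : l * (l * deriv (deriv ub) (l * x)) + p / x * (l * deriv ub (l * x))
          - q / x ^ 2 * ub (l * x)
        = l ^ 2 * (deriv (deriv ub) (l * x) + p / (l * x) * deriv ub (l * x)
          - q / (l * x) ^ 2 * ub (l * x)) := by
      field_simp
    simp only [hid]
    have h3 := mul_le_mul_of_nonneg_left h2 (sq_nonneg l)
    have h4 : l ^ 2 * F (ub (l * x)) ≤ F (ub (l * x)) :=
      (mul_le_mul_of_nonpos_right (one_le_pow₀ hl) (hF _ (hmem _ hlx))).trans_eq (one_mul _)
    exact h3.trans h4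
  · right
    refine ⟨dl * l, dr * l, ?_, ?_, mul_lt_mul_of_pos_right h3 hl0⟩
    · exact h1.comp x hlin.hasDerivWithinAt fun y hy => mul_lt_mul_of_pos_left hy hl0
    · exact h2.comp x hlin.hasDerivWithinAt fun y hy => mul_lt_mul_of_pos_left hy hl0

lemma AsympZero.tendsto_div {u : ℝ → ℝ} {α γ : ℝ} (h : AsympZero u α γ) :
    Tendsto (fun r : ℝ => u r / r ^ γ) (𝓝[>] 0) (𝓝 α) := by
  have h1 := Tendsto.add_const α h
  rw [zero_add] at h1
  refine h1.congr' ?_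
  filter_upwards [self_mem_nhdsWithin] with r hr
  have : r ^ γ ≠ 0 := (Real.rpow_pos_of_pos hr γ).ne'
  field_simp
  ring

lemma AsympInfty.tendsto_mul {u : ℝ → ℝ} {sp β : ℝ} (h : AsympInfty u sp β) :
    Tendsto (fun r : ℝ => (sp - u r) * r ^ 2) atTop (𝓝 β) := by
  have h1 := Tendsto.const_sub β h
  rw [sub_zero] at h1
  refine h1.congr' ?_
  filter_upwards [eventually_gt_atTop 0] with r hr
  field_simp
  ring

lemma AsympZero.tendsto_zero {u : ℝ → ℝ} {α γ : ℝ} (hγ : 0 < γ) (h : AsympZero u α γ) :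
    Tendsto u (𝓝[>] 0) (𝓝 0) := by
  have h1 : Tendsto (fun r : ℝ => r ^ γ) (𝓝[>] 0) (𝓝 0) := by
    have := (Real.continuousAt_rpow_const 0 γ (Or.inr hγ.le)).tendsto
    rw [Real.zero_rpow hγ.ne'] at this
    exact this.mono_left nhdsWithin_le_nhds
  have h2 := h.tendsto_div.mul h1
  rw [mul_zero] at h2
  refine h2.congr' ?_
  filter_upwards [self_mem_nhdsWithin] with r hr
  exact div_mul_cancel₀ _ (Real.rpow_pos_of_pos hr γ).ne'

lemma AsympInfty.tendsto_atTop {u : ℝ → ℝ} {sp β : ℝ} (h : AsympInfty u sp β) :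
    Tendsto u atTop (𝓝 sp) := by
  have h1 : Tendsto (fun r : ℝ => (r ^ 2)⁻¹) atTop (𝓝 0) :=
    tendsto_inv_atTop_zero.comp (tendsto_pow_atTop two_ne_zero)
  have h2 := (h.tendsto_mul.mul h1).const_sub sp
  rw [mul_zero, sub_zero] at h2
  refine h2.congr' ?_
  filter_upwards [eventually_gt_atTop 0] with r hr
  field_simp
  ring

/-- If the scaling factor `l` tends to `l₀` with `1 / l² → c` and `β c < β'`, then `ub (l * r)`
is above `lb r` for all large `r`. -/
lemma eventually_lt_near_infty {ub lb : ℝ → ℝ} {sp β β' c : ℝ} {f : Filter ℝ}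
    (hub : AsympInfty ub sp β) (hlb : AsympInfty lb sp β')
    (hf : Tendsto (fun l : ℝ => (l ^ 2)⁻¹) f (𝓝 c)) (hf1 : ∃ m > 0, ∀ᶠ l in f, m ≤ l)
    (hlt : β * c < β') :
    ∃ R > 0, ∀ᶠ l in f, ∀ r, R ≤ r → lb r < ub (l * r) := by
  obtain ⟨m, hm, hml⟩ := hf1
  have hmul : Tendsto (fun z : ℝ × ℝ => z.1 * z.2) (f ×ˢ atTop) atTop := by
    refine tendsto_atTop_mono' _ ?_ ((tendsto_id.const_mul_atTop hm).comp tendsto_snd)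
    filter_upwards [hml.prod_mk (eventually_ge_atTop (0 : ℝ))] with z hz
    exact mul_le_mul_of_nonneg_right hz.1 hz.2
  have h1 := ((hub.tendsto_mul.comp hmul).mul (hf.comp tendsto_fst)).sub
    (hlb.tendsto_mul.comp tendsto_snd)
  have h2 := h1.eventually (gt_mem_nhds (show β * c - β' < 0 by linarith))
  have h3 := h2.and (hml.prod_mk (eventually_gt_atTop (0 : ℝ)))
  have h4 : ∀ᶠ z : ℝ × ℝ in f ×ˢ atTop, lb z.2 < ub (z.1 * z.2) := by
    filter_upwards [h3] with z ⟨hz1, hz2, hz3⟩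
    have hz4 : 0 < z.1 := by linarith
    have e : (sp - ub (z.1 * z.2)) * (z.1 * z.2) ^ 2 * (z.1 ^ 2)⁻¹ - (sp - lb z.2) * z.2 ^ 2
        = (lb z.2 - ub (z.1 * z.2)) * z.2 ^ 2 := by
      field_simp
      ring
    simp only [Function.comp_apply, e] at hz1
    have := neg_of_mul_neg_left hz1 (sq_nonneg z.2)
    linarith
  obtain ⟨P, hP, Q, hQ, hPQ⟩ := eventually_prod_iff.1 h4
  obtain ⟨R, hR⟩ := eventually_atTop.1 hQ
  refine ⟨max R 1, by positivity, ?_⟩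
  filter_upwards [hP] with l hl r hr
  exact hPQ hl (hR r ((le_max_left _ _).trans hr))

lemma eventually_lt_near_zero {ub lb : ℝ → ℝ} {α α' γ l₀ : ℝ} (hl₀ : 0 < l₀)
    (hub : AsympZero ub α γ) (hlb : AsympZero lb α' γ) (hlt : α' < α * l₀ ^ γ) :
    ∃ δ > 0, ∀ᶠ l in 𝓝 l₀, ∀ r ∈ Ioo 0 δ, lb r < ub (l * r) := by
  have hpos : ∀ᶠ z : ℝ × ℝ in 𝓝 l₀ ×ˢ 𝓝[>] 0, 0 < z.1 ∧ 0 < z.2 :=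
    (lt_mem_nhds hl₀).prod_mk self_mem_nhdsWithin
  have hmul : Tendsto (fun z : ℝ × ℝ => z.1 * z.2) (𝓝 l₀ ×ˢ 𝓝[>] 0) (𝓝[>] 0) := by
    refine tendsto_nhdsWithin_iff.2 ⟨?_, ?_⟩
    · have := (tendsto_fst (f := 𝓝 l₀) (g := 𝓝[>] (0 : ℝ))).mul
        (tendsto_snd.mono_right nhdsWithin_le_nhds)
      simpa using this
    · filter_upwards [hpos] with z hz
      exact mul_pos hz.1 hz.2
  have hpow : Tendsto (fun l : ℝ => l ^ γ) (𝓝 l₀) (𝓝 (l₀ ^ γ)) :=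
    Real.continuousAt_rpow_const _ _ (Or.inl hl₀.ne')
  have h1 := ((hub.tendsto_div.comp hmul).mul (hpow.comp tendsto_fst)).sub
    (hlb.tendsto_div.comp tendsto_snd)
  have h2 := h1.eventually (lt_mem_nhds (show 0 < α * l₀ ^ γ - α' by linarith))
  have h4 : ∀ᶠ z : ℝ × ℝ in 𝓝 l₀ ×ˢ 𝓝[>] 0, lb z.2 < ub (z.1 * z.2) := by
    filter_upwards [h2, hpos] with z hz1 ⟨hz2, hz3⟩
    have p1 := Real.rpow_pos_of_pos hz2 γ
    have p2 := Real.rpow_pos_of_pos hz3 γ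
    have e : ub (z.1 * z.2) / (z.1 * z.2) ^ γ * z.1 ^ γ - lb z.2 / z.2 ^ γ
        = (ub (z.1 * z.2) - lb z.2) / z.2 ^ γ := by
      rw [Real.mul_rpow hz2.le hz3.le]
      field_simp
    simp only [Function.comp_apply, e] at hz1
    have := (div_pos_iff_of_pos_right p2).1 hz1
    linarith
  obtain ⟨P, hP, Q, hQ, hPQ⟩ := eventually_prod_iff.1 h4
  obtain ⟨δ, hδ, hQδ⟩ := mem_nhdsGT_iff_exists_Ioo_subset.1 hQ
  refine ⟨δ, hδ, ?_⟩
  filter_upwards [hP] with l hl r hr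
  exact hPQ hl (hQδ hr)

/-- Strict ordering at the factor `l₀`, at all `r` and in the asymptotics, is stable under small
changes of the factor. -/
lemma eventually_forall_lt {ub lb : ℝ → ℝ} {sp α α' γ β β' l₀ : ℝ} (hl₀ : 0 < l₀)
    (hcu : ∀ r : ℝ, 0 < r → ContinuousAt ub r) (hcl : ∀ r : ℝ, 0 < r → ContinuousAt lb r)
    (hub0 : AsympZero ub α γ) (hlb0 : AsympZero lb α' γ) (hα : α' < α * l₀ ^ γ)
    (hub : AsympInfty ub sp β) (hlb : AsympInfty lb sp β') (hβ : β * (l₀ ^ 2)⁻¹ < β')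
    (hlt : ∀ r : ℝ, 0 < r → lb r < ub (l₀ * r)) :
    ∀ᶠ l in 𝓝 l₀, ∀ r : ℝ, 0 < r → lb r < ub (l * r) := by
  obtain ⟨δ, hδ, h1⟩ := eventually_lt_near_zero hl₀ hub0 hlb0 hα
  obtain ⟨R, hR, h2⟩ := eventually_lt_near_infty (f := 𝓝 l₀) hub hlb
    (((continuousAt_id.pow 2).inv₀ (by simpa using hl₀.ne')).tendsto)
    ⟨l₀ / 2, by positivity, (lt_mem_nhds (by linarith)).mono fun _ h => le_of_lt h⟩ hβ
  have h3 : ∀ᶠ l in 𝓝 l₀, ∀ r ∈ Icc δ R, lb r < ub (l * r) := by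
    refine isCompact_Icc.eventually_forall_of_forall_eventually fun r hr => ?_
    have hr0 : 0 < r := lt_of_lt_of_le hδ hr.1
    have c1 : ContinuousAt (fun z : ℝ × ℝ => ub (z.1 * z.2)) (l₀, r) :=
      ContinuousAt.comp (g := ub) (f := fun z : ℝ × ℝ => z.1 * z.2)
        (hcu _ (mul_pos hl₀ hr0)) (continuousAt_fst.mul continuousAt_snd)
    have c2 : ContinuousAt (fun z : ℝ × ℝ => lb z.2) (l₀, r) :=
      ContinuousAt.comp (g := lb) (f := fun z : ℝ × ℝ => z.2) (hcl _ hr0) continuousAt_snd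
    exact c2.eventually_lt c1 (hlt r hr0)
  filter_upwards [h1, h2, h3] with l a1 a2 a3 r hr
  rcases lt_or_ge r δ with hr1 | hr1
  · exact a1 r ⟨hr, hr1⟩
  rcases le_total R r with hr2 | hr2
  · exact a2 r hr2
  · exact a3 r ⟨hr1, hr2⟩

/-- For large scaling factors the scaled super-solution is above the sub-solution. -/
lemma eventually_atTop_forall_le {ub lb : ℝ → ℝ} {sp α α' γ β β' : ℝ} (hsp : 0 < sp)
    (hγ : 0 < γ) (hcu : ∀ r : ℝ, 0 < r → ContinuousAt ub r)
    (hcl : ∀ r : ℝ, 0 < r → ContinuousAt lb r)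
    (hupos : ∀ r : ℝ, 0 < r → 0 < ub r) (hllt : ∀ r : ℝ, 0 < r → lb r < sp)
    (hub0 : AsympZero ub α γ) (hlb0 : AsympZero lb α' γ) (hα : 0 < α)
    (hub : AsympInfty ub sp β) (hlb : AsympInfty lb sp β') (hβ : 0 < β') :
    ∀ᶠ l in atTop, ∀ r : ℝ, 0 < r → lb r ≤ ub (l * r) := by
  obtain ⟨R, hR, hinf⟩ := eventually_lt_near_infty (f := atTop) (c := 0) hub hlb
    (tendsto_inv_atTop_zero.comp (tendsto_pow_atTop two_ne_zero))
    ⟨1, one_pos, eventually_ge_atTop 1⟩ (by simpa using hβ)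
  obtain ⟨T', hT'⟩ := eventually_atTop.1
    (hub.tendsto_atTop.eventually (lt_mem_nhds (show sp / 2 < sp by linarith)))
  set T := max T' 1 with hTdef
  have hT : ∀ t, T ≤ t → sp / 2 < ub t := fun t ht => hT' t ((le_max_left _ _).trans ht)
  have hT0 : 0 < T := lt_of_lt_of_le one_pos (le_max_right _ _)
  obtain ⟨t₀, ht₀, hnear⟩ := mem_nhdsGT_iff_exists_Ioo_subset.1
    (hub0.tendsto_div.eventually (lt_mem_nhds (show α / 2 < α by linarith)))
  have ht₀' : 0 < t₀ := ht₀
  obtain ⟨c, hc, hlow⟩ : ∃ c > 0, ∀ t ∈ Ioc 0 T, c * t ^ γ ≤ ub t := by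
    obtain ⟨c, hc, hcmin⟩ : ∃ c > 0, ∀ t ∈ Icc t₀ T, c ≤ ub t / t ^ γ := by
      have hcont : ContinuousOn (fun t => ub t / t ^ γ) (Icc t₀ T) := fun t ht => by
        have ht0 : 0 < t := ht₀'.trans_le ht.1
        exact ((hcu t ht0).div (Real.continuousAt_rpow_const _ _ (Or.inl ht0.ne'))
          (Real.rpow_pos_of_pos ht0 γ).ne').continuousWithinAt
      obtain ⟨c, hc, h⟩ := isCompact_Icc.exists_forall_le' hcont (a := 0) fun t ht => by
        have ht0 : 0 < t := ht₀'.trans_le ht.1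
        exact div_pos (hupos t ht0) (Real.rpow_pos_of_pos ht0 γ)
      exact ⟨c, hc, h⟩
    refine ⟨min c (α / 2), lt_min hc (by linarith), fun t ht => ?_⟩
    have htγ := Real.rpow_pos_of_pos ht.1 γ
    rw [← le_div_iff₀ htγ]
    rcases lt_or_ge t t₀ with h | h
    · exact (min_le_right _ _).trans (le_of_lt (hnear ⟨ht.1, h⟩))
    · exact (min_le_left _ _).trans (hcmin t ⟨h, ht.2⟩)
  obtain ⟨δ, hδ, hlbδ⟩ := mem_nhdsGT_iff_exists_Ioo_subset.1
    ((hlb0.tendsto_div.eventually (gt_mem_nhds (show α' < |α'| + 1 by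
      linarith [le_abs_self α']))).and
      ((hlb0.tendsto_zero hγ).eventually (gt_mem_nhds (show 0 < sp / 2 by linarith))))
  have hδ' : 0 < δ := hδ
  obtain ⟨s, hs, hmid⟩ : ∃ s < sp, ∀ r ∈ Icc δ R, lb r ≤ s := by
    have hcont : ContinuousOn lb (Icc δ R) := fun r hr =>
      (hcl r (hδ'.trans_le hr.1)).continuousWithinAt
    obtain ⟨c, hc, h⟩ := isCompact_Icc.exists_forall_le' (continuousOn_const.sub hcont) (a := 0)
      fun r hr => sub_pos (a := sp).2 (hllt r (hδ'.trans_le hr.1))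
    exact ⟨sp - c, by linarith, fun r hr => le_sub_comm.1 (h r hr)⟩
  obtain ⟨T₁, hT₁⟩ := eventually_atTop.1 (hub.tendsto_atTop.eventually (lt_mem_nhds hs))
  have hpow := (tendsto_rpow_atTop hγ).const_mul_atTop hc
  filter_upwards [hinf, eventually_ge_atTop (T₁ / δ), eventually_gt_atTop 0,
    hpow.eventually (eventually_ge_atTop (|α'| + 1))] with l hl1 hl2 hl3 hl4 r hr
  have hlr : 0 < l * r := mul_pos hl3 hr
  rcases lt_or_ge r δ with hr1 | hr1
  · obtain ⟨g1, g2⟩ := hlbδ ⟨hr, hr1⟩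
    rcases le_total T (l * r) with h | h
    · exact (le_of_lt g2).trans (hT _ h).le
    · have hrγ := Real.rpow_pos_of_pos hr γ
      have h1 := hlow (l * r) ⟨hlr, h⟩
      rw [Real.mul_rpow hl3.le hr.le, ← mul_assoc] at h1
      have h2 : lb r < (|α'| + 1) * r ^ γ := (div_lt_iff₀ hrγ).1 g1
      have h3 := mul_le_mul_of_nonneg_right hl4 hrγ.le
      linarith
  rcases le_total R r with hr2 | hr2
  · exact (hl1 r hr2).le
  · refine (hmid r ⟨hr1, hr2⟩).trans (hT₁ _ ?_).le
    calc T₁ = T₁ / δ * δ := (div_mul_cancel₀ _ hδ'.ne').symm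
      _ ≤ l * δ := mul_le_mul_of_nonneg_right hl2 hδ'.le
      _ ≤ l * r := mul_le_mul_of_nonneg_left hr1 hl3.le

lemma CondF.nonpos {F : ℝ → ℝ} {sp : ℝ} (hF : CondF F sp) : ∀ t ∈ Icc 0 sp, F t ≤ 0 := by
  obtain ⟨-, h0, h1, h2, -⟩ := hF
  intro t ht
  rcases ht.1.eq_or_lt with rfl | ht0
  · exact h0.le
  rcases ht.2.eq_or_lt with rfl | ht1
  · exact h1.le
  exact (h2 t ⟨ht0, ht1⟩).le

lemma CondF.exists_lipschitz {F : ℝ → ℝ} {sp : ℝ} (hF : CondF F sp) :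
    ∃ L ≥ 0, ∀ x ∈ Icc 0 sp, ∀ y ∈ Icc 0 sp, x ≤ y → F y - F x ≤ L * (y - x) := by
  obtain ⟨K, hK⟩ := (hF.1.locallyLipschitz.locallyLipschitzOn
    (s := Icc 0 sp)).exists_lipschitzOnWith_of_compact isCompact_Icc
  refine ⟨K, K.2, fun x hx y hy hxy => ?_⟩
  have := hK.dist_le_mul y hy x hx
  rw [Real.dist_eq, Real.dist_eq, abs_of_nonneg (sub_nonneg.2 hxy)] at this
  exact (le_abs_self _).trans this

lemma gammaPlus_pos {p q : ℝ} (hq : 0 < q) : 0 < gammaPlus p q := by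
  have : |p - 1| < Real.sqrt ((p - 1) ^ 2 + 4 * q) := by
    rw [← Real.sqrt_sq_eq_abs]
    exact Real.sqrt_lt_sqrt (sq_nonneg _) (by linarith)
  have h2 := le_abs_self (p - 1)
  unfold gammaPlus
  linarith

lemma gammaPlus_root {p q : ℝ} (hq : 0 < q) :
    gammaPlus p q ^ 2 + (p - 1) * gammaPlus p q - q = 0 := by
  have := Real.sq_sqrt (show 0 ≤ (p - 1) ^ 2 + 4 * q by positivity)
  unfold gammaPlus
  nlinarith

/-- comparison principle on `(0,∞)`: `ū ≥ u̲`, and if equality holds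
somewhere then `ū ≡ u̲`. -/
theorem stmt5 (p q sp : ℝ) (hp : 0 ≤ p) (hq : 0 < q) (hsp : 0 < sp)
    (F : ℝ → ℝ) (hF : CondF F sp)
    (ub lb : ℝ → ℝ) (αb αl βb βl : ℝ)
    (hsuper : IsSuperSolutionOn p q F (Set.Ioi 0) ub)
    (hsub : IsSubSolutionOn p q F (Set.Ioi 0) lb)
    (hubnd : ∀ r ∈ Set.Ioi (0:ℝ), 0 ≤ ub r ∧ ub r ≤ sp)
    (hlbnd : ∀ r ∈ Set.Ioi (0:ℝ), 0 ≤ lb r ∧ lb r ≤ sp)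
    (hαb : 0 < αb)
    (h0ub : AsympZero ub αb (gammaPlus p q))
    (h0lb : AsympZero lb αl (gammaPlus p q))
    (hβl : 0 < βl)
    (hiub : AsympInfty ub sp βb)
    (hilb : AsympInfty lb sp βl)
    (hβ : βb ≤ βl) :
    (∀ r : ℝ, 0 < r → lb r ≤ ub r) ∧
      (∀ r₀ : ℝ, 0 < r₀ → ub r₀ = lb r₀ → ∀ r : ℝ, 0 < r → ub r = lb r) := by
  have hγ := gammaPlus_pos (p := p) hq
  have hFnp := hF.nonpos
  obtain ⟨L, hL, hlip⟩ := hF.exists_lipschitz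
  have hus := hsuper.pointwise
  have hls := hsub.pointwise
  have hum : ∀ r : ℝ, 0 < r → ub r ∈ Icc 0 sp := hubnd
  have hlm : ∀ r : ℝ, 0 < r → lb r ∈ Icc 0 sp := hlbnd
  have hcu : ∀ r : ℝ, 0 < r → ContinuousAt ub r := fun r hr => hus.continuousAt hr
  have hcl : ∀ r : ℝ, 0 < r → ContinuousAt lb r := fun r hr => hls.continuousAt hr
  have hupos : ∀ r : ℝ, 0 < r → 0 < ub r := by
    have hpair : OrderedPair p q sp L F ub (fun _ => 0) :=
      { hq := hq, hL := hL, lip := hlip, super := hus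
        sub := fun x _ => Or.inl ⟨contDiffAt_const, by simp [hF.2.1]⟩
        ub_mem := hum
        lb_mem := fun r _ => ⟨le_rfl, hsp.le⟩
        le := fun r hr => (hum r hr).1 }
    intro r hr
    refine lt_of_le_of_ne (hum r hr).1 fun h => ?_
    obtain ⟨t, ht, ht0⟩ := ((h0ub.tendsto_div.eventually (lt_mem_nhds hαb)).and
      self_mem_nhdsWithin).exists
    rw [hpair.eq_of_touch hp hr h.symm ht0, zero_div] at ht
    exact lt_irrefl _ ht
  have hllt : ∀ r : ℝ, 0 < r → lb r < sp := by
    have hpair : OrderedPair p q sp L F (fun _ => sp) lb :=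
      { hq := hq, hL := hL, lip := hlip
        super := fun x hx => Or.inl ⟨contDiffAt_const, by
          have : 0 ≤ q / x ^ 2 * sp := by positivity
          simpa [hF.2.2.1] using this⟩
        sub := hls
        ub_mem := fun r _ => ⟨hsp.le, le_rfl⟩
        lb_mem := hlm
        le := fun r hr => (hlm r hr).2 }
    intro r hr
    refine lt_of_le_of_ne (hlm r hr).2 fun h => ?_
    obtain ⟨t, ht, ht0⟩ := ((hilb.tendsto_mul.eventually (lt_mem_nhds hβl)).and
      (eventually_gt_atTop 0)).exists
    rw [← hpair.eq_of_touch hp hr h.symm ht0, sub_self, zero_mul] at ht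
    exact lt_irrefl _ ht
  have hpair : ∀ l : ℝ, 1 ≤ l → (∀ r : ℝ, 0 < r → lb r ≤ ub (l * r)) →
      OrderedPair p q sp L F (fun r => ub (l * r)) lb := fun l hl hle =>
    { hq := hq, hL := hL, lip := hlip
      super := hus.comp_mul_left hFnp hum hl
      sub := hls
      ub_mem := fun r hr => hum _ (mul_pos (by linarith) hr)
      lb_mem := hlm
      le := hle }
  have hcomp : ∀ r : ℝ, 0 < r → lb r ≤ ub r := by
    by_contra! hbad
    set B : Set ℝ := {l | 1 ≤ l ∧ ∃ r : ℝ, 0 < r ∧ ub (l * r) < lb r} with hB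
    have h1B : (1 : ℝ) ∈ B := ⟨le_rfl, by simpa using hbad⟩
    obtain ⟨Λ, hΛ⟩ := eventually_atTop.1 (eventually_atTop_forall_le hsp hγ hcu hcl hupos hllt
      h0ub h0lb hαb hiub hilb hβl)
    have hbdd : BddAbove B := ⟨Λ, fun l ⟨_, r, hr, hlr⟩ => by
      by_contra! hlt
      exact absurd (hΛ l hlt.le r hr) (not_le.2 hlr)⟩
    set s := sSup B with hs
    have hs1 : 1 ≤ s := le_csSup hbdd h1B
    have hsB : s ∉ B := by
      rintro ⟨-, r, hr, hlr⟩
      have hc : ContinuousAt (fun l => ub (l * r)) s :=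
        ContinuousAt.comp (g := ub) (f := fun l : ℝ => l * r)
          (hcu _ (mul_pos (by linarith) hr)) (continuousAt_id.mul continuousAt_const)
      obtain ⟨l, hl, hsl⟩ := (((hc.eventually_lt continuousAt_const hlr).filter_mono
        nhdsWithin_le_nhds).and (self_mem_nhdsWithin (s := Ioi s))).exists
      exact absurd (le_csSup hbdd ⟨hs1.trans (le_of_lt hsl), r, hr, hl⟩) (not_le.2 hsl)
    have hs1' : 1 < s := lt_of_le_of_ne hs1 fun h => hsB (h ▸ h1B)
    have hs0 : 0 < s := by linarith
    have hsle : ∀ r : ℝ, 0 < r → lb r ≤ ub (s * r) := by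
      intro r hr
      by_contra! hlt
      exact hsB ⟨hs1, r, hr, hlt⟩
    have hps := hpair s hs1 hsle
    have hβs : βb * (s ^ 2)⁻¹ < βl := by
      have hinv : (s ^ 2)⁻¹ < 1 := inv_lt_one_of_one_lt₀ (by nlinarith)
      have hinv0 : 0 < (s ^ 2)⁻¹ := by positivity
      rcases le_or_gt βb 0 with h | h
      · exact lt_of_le_of_lt (mul_nonpos_of_nonpos_of_nonneg h hinv0.le) hβl
      · nlinarith
    have hslt : ∀ r : ℝ, 0 < r → lb r < ub (s * r) := by
      obtain ⟨R, hR, hinf⟩ := eventually_lt_near_infty (f := pure s) hiub hilb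
        (tendsto_pure_nhds _ _) ⟨1, one_pos, hs1⟩ hβs
      intro r hr
      refine lt_of_le_of_ne (hsle r hr) fun h => ?_
      have h1 : lb R < ub (s * R) := (eventually_pure.1 hinf) R le_rfl
      have h2 : ub (s * R) = lb R := hps.eq_of_touch hp hr h.symm hR
      exact h1.ne' h2
    have hαs : αl < αb * s ^ gammaPlus p q := by
      have h2γ : 0 < 2 * gammaPlus p q + p := by
        have := Real.sqrt_nonneg ((p - 1) ^ 2 + 4 * q)
        unfold gammaPlus
        linarith
      obtain ⟨ε, hε, δ, hδ, hhopf⟩ := hps.exists_rpow_le hγ (gammaPlus_root hq) h2γ hslt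
      have hmul : Tendsto (fun r : ℝ => s * r) (𝓝[>] 0) (𝓝[>] 0) := by
        refine tendsto_nhdsWithin_iff.2 ⟨?_, ?_⟩
        · have : Tendsto (fun r : ℝ => s * r) (𝓝 0) (𝓝 (s * 0)) :=
            (continuous_const.mul continuous_id).tendsto 0
          rw [mul_zero] at this
          exact this.mono_left nhdsWithin_le_nhds
        · filter_upwards [self_mem_nhdsWithin] with r hr using mul_pos hs0 hr
      have hlim := ((h0ub.tendsto_div.comp hmul).mul_const (s ^ gammaPlus p q)).sub
        h0lb.tendsto_div
      have : ε ≤ αb * s ^ gammaPlus p q - αl := by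
        refine ge_of_tendsto hlim ?_
        filter_upwards [Ioc_mem_nhdsGT hδ] with r hr
        have p1 := Real.rpow_pos_of_pos hs0 (gammaPlus p q)
        have p2 := Real.rpow_pos_of_pos hr.1 (gammaPlus p q)
        have e : ub (s * r) / (s * r) ^ gammaPlus p q * s ^ gammaPlus p q
            - lb r / r ^ gammaPlus p q = (ub (s * r) - lb r) / r ^ gammaPlus p q := by
          rw [Real.mul_rpow hs0.le hr.1.le]
          field_simp
        rw [Function.comp_apply, e, le_div_iff₀ p2]
        exact hhopf r hr
      linarith
    have hev := eventually_forall_lt hs0 hcu hcl h0ub h0lb hαs hiub hilb hβs hslt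
    obtain ⟨η, hη, hball⟩ := Metric.eventually_nhds_iff.1 hev
    obtain ⟨l, hlB, hl⟩ := exists_lt_of_lt_csSup ⟨1, h1B⟩ (show s - η < sSup B by linarith)
    have hls' : l ≤ s := le_csSup hbdd hlB
    obtain ⟨-, r, hr, hlr⟩ := hlB
    have := hball (y := l) (by rw [Real.dist_eq, abs_lt]; constructor <;> linarith) r hr
    linarith
  refine ⟨hcomp, fun r₀ hr₀ h r hr => ?_⟩
  have h1 := hpair 1 le_rfl (by simpa using hcomp)
  simpa using h1.eq_of_touch hp hr₀ (by simpa using h) hr
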